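/- arXiv:1303.1647 — 2 statements merged into one kernel-verified Lean document; each statement's English description precedes it below -/
import Mathlib

section
/- Fix γ̄ > 0, ε̄ > 0 and ε ∈ (ε̄, (3/2)ε̄), set k = √(ε̄/(3ε̄ − 2ε)) − 1 (so k > 0) and assume k ≠ 1; let ν = γ̄ k/(2ε̄). Let γ₁, γ₂ be i.i.d. with density (2/γ̄)e^{−2x/γ̄}, ε₁, ε₂ i.i.d. exponential with mean ε̄, all independent, and let s = 1 if γ₁ − γ₂ > ν(ε₂ − ε₁), s = 2 otherwise. Then (i) E[ε_s] = ε, and (ii) E[(1/2)log₂(1+γ_s)] = e^{2/γ̄}·[ 2(1 − k²)E₁(2/γ̄) + k² e^{2/(γ̄ k)} E₁( (2/γ̄)(1 + 1/k) ) − e^{2/γ̄} E₁(4/γ̄) ] / ( 2(1 − k²) ln 2 ). (Proposition 1: the capacity–energy tradeoff achieved by the weighted difference relay selection scheme.) -/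
open MeasureTheory ProbabilityTheory Real

/-- The exponential integral `E₁(z) = ∫₁^∞ e^{-z y}/y dy`. -/
noncomputable def E1 (z : ℝ) : ℝ := ∫ y in Set.Ioi (1 : ℝ), Real.exp (-z * y) / y

/-- The joint law of `(γ₁, γ₂, ε₁, ε₂)`: `γ₁, γ₂` are i.i.d. with density
`(2/γ̄)e^{-2x/γ̄}` on `(0,∞)` (exponential with rate `2/γ̄`), `ε₁, ε₂` are i.i.d.
exponential with mean `ε̄` (rate `1/ε̄`), and all four are mutually independent.
A sample point `ω` has `ω.1 = γ₁`, `ω.2.1 = γ₂`, `ω.2.2.1 = ε₁`, `ω.2.2.2 = ε₂`. -/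
noncomputable def wdMeasure (γbar εbar : ℝ) : Measure (ℝ × ℝ × ℝ × ℝ) :=
  (expMeasure (2 / γbar)).prod
    ((expMeasure (2 / γbar)).prod ((expMeasure (1 / εbar)).prod (expMeasure (1 / εbar))))

open Set Filter Topology

lemma integral_expMeasure {r : ℝ} (hr : 0 < r) (f : ℝ → ℝ) :
    ∫ x, f x ∂(expMeasure r) = ∫ x in Ioi (0 : ℝ), r * (f x * exp (-r * x)) := by
  have h : expMeasure r = volume.withDensity (exponentialPDF r) := rfl
  have hm : Measurable (exponentialPDF r) := (measurable_exponentialPDFReal r).ennreal_ofReal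
  rw [h, integral_withDensity_eq_integral_toReal_smul hm
    (ae_of_all _ fun x => ENNReal.ofReal_lt_top), ← integral_Ici_eq_integral_Ioi,
    ← integral_indicator measurableSet_Ici]
  congr 1 with x
  by_cases hx : 0 ≤ x
  · rw [indicator_of_mem (by exact hx), exponentialPDF_of_nonneg hx,
      ENNReal.toReal_ofReal (by positivity), smul_eq_mul]
    ring_nf
  · rw [indicator_of_notMem (by simpa using hx), exponentialPDF_of_neg (not_le.mp hx)]
    simp

lemma integrable_expMeasure {r : ℝ} (hr : 0 < r) {f : ℝ → ℝ}
    (hf : IntegrableOn (fun x => f x * exp (-r * x)) (Ioi 0)) :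
    Integrable f (expMeasure r) := by
  have h : expMeasure r = volume.withDensity (exponentialPDF r) := rfl
  have hm : Measurable (exponentialPDF r) := (measurable_exponentialPDFReal r).ennreal_ofReal
  rw [h, integrable_withDensity_iff_integrable_smul' hm
    (ae_of_all _ fun x => ENNReal.ofReal_lt_top)]
  have h' := (integrableOn_Ici_iff_integrableOn_Ioi (by finiteness)).mpr (hf.const_mul r)
  rw [← integrable_indicator_iff measurableSet_Ici] at h'
  refine h'.congr (ae_of_all _ fun x => ?_)
  simp only
  by_cases hx : 0 ≤ x
  · rw [indicator_of_mem (by exact hx), exponentialPDF_of_nonneg hx,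
      ENNReal.toReal_ofReal (by positivity), smul_eq_mul]
    ring_nf
  · rw [indicator_of_notMem (by simpa using hx), exponentialPDF_of_neg (not_le.mp hx)]
    simp

instance nullSingletonClass_expMeasure (r : ℝ) : NullSingletonClass (expMeasure r) :=
  inferInstanceAs (NullSingletonClass (volume.withDensity (exponentialPDF r)))

lemma expMeasure_real_Iio {r : ℝ} (hr : 0 < r) (x : ℝ) :
    (expMeasure r).real (Iio x) = if 0 ≤ x then 1 - exp (-(r * x)) else 0 := by
  have := isProbabilityMeasure_expMeasure hr
  rw [← cdf_expMeasure_eq hr, cdf_eq_real]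
  exact measureReal_congr Iio_ae_eq_Iic

/-- The distribution function of the difference of two independent exponential variables of
rate `c`, that is, of the Laplace distribution. -/
noncomputable def laplaceCDF (c u : ℝ) : ℝ :=
  if 0 ≤ u then 1 - exp (-c * u) / 2 else exp (c * u) / 2

lemma laplaceCDF_neg (c u : ℝ) : laplaceCDF c (-u) = 1 - laplaceCDF c u := by
  unfold laplaceCDF
  rcases lt_trichotomy u 0 with h | rfl | h
  · rw [if_pos (by linarith), if_neg (by linarith)]; ring_nf
  · norm_num
  · rw [if_neg (by linarith), if_pos (by linarith)]; ring_nf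

lemma laplaceCDF_div {v : ℝ} (hv : 0 < v) (c u : ℝ) :
    laplaceCDF c (u / v) = laplaceCDF (c / v) u := by
  have h : 0 ≤ u / v ↔ 0 ≤ u := by rw [le_div_iff₀ hv, zero_mul]
  simp only [laplaceCDF, h]
  ring_nf

lemma integral_exp_neg_mul_Ioi {r : ℝ} (hr : 0 < r) (c : ℝ) :
    ∫ x in Ioi c, exp (-r * x) = exp (-r * c) / r := by
  rw [integral_exp_mul_Ioi (neg_neg_of_pos hr), neg_div_neg_eq]

lemma expMeasure_prod_real_sub_lt {c : ℝ} (hc : 0 < c) (t : ℝ) :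
    ((expMeasure c).prod (expMeasure c)).real {q | q.2 - q.1 < t} = laplaceCDF c t := by
  have := isProbabilityMeasure_expMeasure hc
  have hS : MeasurableSet {q : ℝ × ℝ | q.2 - q.1 < t} :=
    measurableSet_lt (by fun_prop) (by fun_prop)
  have h1 : ∀ x : ℝ, Prod.mk x ⁻¹' {q : ℝ × ℝ | q.2 - q.1 < t} = Iio (t + x) := by
    intro x; ext y; simp [sub_lt_iff_lt_add]
  have h2 : ((expMeasure c).prod (expMeasure c)).real {q | q.2 - q.1 < t}
      = ∫ x, (if 0 ≤ t + x then 1 - exp (-(c * (t + x))) else 0) ∂(expMeasure c) := by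
    rw [measureReal_def, Measure.prod_apply hS, ← integral_toReal
      (measurable_measure_prodMk_left hS).aemeasurable (ae_of_all _ fun x => measure_lt_top _ _)]
    congr 1 with x
    rw [h1, ← measureReal_def, expMeasure_real_Iio hc]
  rw [h2, integral_expMeasure hc]
  have hi : ∀ s : ℝ, ∫ x in Ioi s, c * ((1 - exp (-(c * (t + x)))) * exp (-c * x))
      = exp (-c * s) - exp (-c * t) * exp (-(2 * c) * s) / 2 := by
    intro s
    have e : ∀ x : ℝ, c * ((1 - exp (-(c * (t + x)))) * exp (-c * x))
        = c * exp (-c * x) - c * exp (-c * t) * exp (-(2 * c) * x) := by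
      intro x
      have : exp (-(c * (t + x))) * exp (-c * x) = exp (-c * t) * exp (-(2 * c) * x) := by
        rw [← exp_add, ← exp_add]; ring_nf
      linear_combination -c * this
    simp_rw [e]
    rw [integral_sub ((exp_neg_integrableOn_Ioi s hc).const_mul _)
      ((exp_neg_integrableOn_Ioi s (by positivity)).const_mul _), integral_const_mul,
      integral_const_mul, integral_exp_neg_mul_Ioi hc, integral_exp_neg_mul_Ioi (by positivity)]
    field_simp
  unfold laplaceCDF
  split_ifs with ht
  · rw [setIntegral_congr_fun (g := fun x => c * ((1 - exp (-(c * (t + x)))) * exp (-c * x)))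
      measurableSet_Ioi fun x (hx : 0 < x) => by
        simp only; rw [if_pos (by linarith)], hi]
    simp
  · push Not at ht
    have hg : ∀ x : ℝ, c * ((if 0 ≤ t + x then 1 - exp (-(c * (t + x))) else 0) * exp (-c * x))
        = (Ici (-t)).indicator (fun x => c * ((1 - exp (-(c * (t + x)))) * exp (-c * x))) x := by
      intro x
      by_cases h : 0 ≤ t + x
      · rw [if_pos h, indicator_of_mem (by simp only [mem_Ici]; linarith)]
      · rw [if_neg h, indicator_of_notMem (by simp only [mem_Ici]; linarith)]; simp
    simp_rw [hg]
    rw [setIntegral_indicator measurableSet_Ici,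
      inter_eq_right.mpr (show Ici (-t) ⊆ Ioi 0 from Ici_subset_Ioi.mpr (by linarith)),
      integral_Ici_eq_integral_Ioi, hi, ← exp_add]
    ring_nf

/-- Probability that `Y + U < x` for independent `Y` exponential of rate `a` and `U` Laplace of
rate `c`. -/
lemma integral_laplaceCDF_expMeasure {a c : ℝ} (ha : 0 < a) (hc : 0 < c) (hac : c ≠ a)
    {x : ℝ} (hx : 0 < x) :
    ∫ y, laplaceCDF c (x - y) ∂(expMeasure a)
      = 1 - c ^ 2 / (c ^ 2 - a ^ 2) * exp (-a * x) + a / (2 * (c - a)) * exp (-c * x) := by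
  have hca : c - a ≠ 0 := sub_ne_zero.mpr hac
  have hca' : c + a ≠ 0 := by positivity
  have hca2 : c ^ 2 - a ^ 2 ≠ 0 := by rw [sq_sub_sq]; exact mul_ne_zero hca' hca
  rw [integral_expMeasure ha, ← Ioc_union_Ioi_eq_Ioi hx.le]
  let F : ℝ → ℝ := fun y => -exp (-a * y) - a / (2 * (c - a)) * exp (-c * x) * exp ((c - a) * y)
  have hF : ∀ y, HasDerivAt F (a * exp (-a * y)
      - a / 2 * exp (-c * x) * exp ((c - a) * y)) y := by
    intro y
    have h1 := ((hasDerivAt_id y).const_mul (-a)).exp.neg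
    have h2 := (((hasDerivAt_id y).const_mul (c - a)).exp.const_mul
      (a / (2 * (c - a)) * exp (-c * x)))
    refine (h1.sub h2).congr_deriv ?_
    simp only [id]
    field_simp
  have e1 : EqOn (fun y => a * (laplaceCDF c (x - y) * exp (-a * y)))
      (fun y => a * exp (-a * y) - a / 2 * exp (-c * x) * exp ((c - a) * y)) (Ioc 0 x) := by
    intro y hy
    have : exp (-c * (x - y)) * exp (-a * y) = exp (-c * x) * exp ((c - a) * y) := by
      rw [← exp_add, ← exp_add]; ring_nf
    simp only [laplaceCDF, if_pos (sub_nonneg.mpr hy.2)]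
    linear_combination -a / 2 * this
  have e2 : EqOn (fun y => a * (laplaceCDF c (x - y) * exp (-a * y)))
      (fun y => a / 2 * exp (c * x) * exp (-(c + a) * y)) (Ioi x) := by
    intro y (hy : x < y)
    have : exp (c * (x - y)) * exp (-a * y) = exp (c * x) * exp (-(c + a) * y) := by
      rw [← exp_add, ← exp_add]; ring_nf
    simp only [laplaceCDF, if_neg (show ¬ 0 ≤ x - y by linarith)]
    linear_combination a / 2 * this
  have i1 : ∀ s t : ℝ, IntervalIntegrable (fun y => a * exp (-a * y)
      - a / 2 * exp (-c * x) * exp ((c - a) * y)) volume s t :=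
    fun s t => Continuous.intervalIntegrable (by fun_prop) _ _
  have i2 : IntegrableOn (fun y => a / 2 * exp (c * x) * exp (-(c + a) * y)) (Ioi x) :=
    (exp_neg_integrableOn_Ioi x (by positivity)).const_mul _
  rw [setIntegral_union (Ioc_disjoint_Ioi le_rfl) measurableSet_Ioi
    (((i1 0 x).1).congr_fun e1.symm measurableSet_Ioc) (i2.congr_fun e2.symm measurableSet_Ioi),
    setIntegral_congr_fun measurableSet_Ioc e1, setIntegral_congr_fun measurableSet_Ioi e2,
    ← intervalIntegral.integral_of_le hx.le,
    intervalIntegral.integral_eq_sub_of_hasDerivAt (fun y _ => hF y) (i1 0 x),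
    integral_const_mul, integral_exp_neg_mul_Ioi (by positivity)]
  have x1 : exp (-c * x) * exp ((c - a) * x) = exp (-a * x) := by rw [← exp_add]; ring_nf
  have x2 : exp (c * x) * exp (-(c + a) * x) = exp (-a * x) := by rw [← exp_add]; ring_nf
  have x3 : c ^ 2 / (c ^ 2 - a ^ 2) = 1 + a / (2 * (c - a)) - a / (2 * (c + a)) := by
    field_simp; ring
  simp only [F, mul_zero, exp_zero, x3]
  have x4 : a / 2 * exp (c * x) * (exp (-(c + a) * x) / (c + a))
    = a / (2 * (c + a)) * (exp (c * x) * exp (-(c + a) * x)) := by field_simp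
  rw [x4, x2]
  linear_combination (-a / (2 * (c - a))) * x1

@[fun_prop]
lemma measurable_laplaceCDF (c : ℝ) : Measurable (laplaceCDF c) :=
  Measurable.ite measurableSet_Ici (by fun_prop) (by fun_prop)

lemma laplaceCDF_mem_Icc {c : ℝ} (hc : 0 < c) (u : ℝ) : laplaceCDF c u ∈ Icc (0 : ℝ) 1 := by
  have := isProbabilityMeasure_expMeasure hc
  rw [← expMeasure_prod_real_sub_lt hc]
  exact ⟨measureReal_nonneg, measureReal_le_one⟩

lemma integral_ite_sub_lt {b v : ℝ} (hb : 0 < b) (hv : 0 < v) (u P Q : ℝ) :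
    ∫ q : ℝ × ℝ, (if v * (q.2 - q.1) < u then P else Q) ∂((expMeasure b).prod (expMeasure b))
      = P * laplaceCDF (b / v) u + Q * laplaceCDF (b / v) (-u) := by
  have := isProbabilityMeasure_expMeasure hb
  have hS : MeasurableSet {q : ℝ × ℝ | q.2 - q.1 < u / v} :=
    measurableSet_lt (by fun_prop) (by fun_prop)
  have e : ∀ q : ℝ × ℝ, (if v * (q.2 - q.1) < u then P else Q)
      = {q : ℝ × ℝ | q.2 - q.1 < u / v}.indicator (fun _ => P - Q) q + Q := by
    intro q
    have h : v * (q.2 - q.1) < u ↔ q.2 - q.1 < u / v := by rw [lt_div_iff₀ hv, mul_comm]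
    by_cases hq : q.2 - q.1 < u / v
    · rw [if_pos (h.mpr hq), indicator_of_mem (by exact hq)]; ring
    · rw [if_neg (mt h.mp hq), indicator_of_notMem (by exact hq)]; ring
  simp_rw [e]
  rw [integral_add ((integrable_const _).indicator hS) (integrable_const _),
    integral_indicator_const _ hS, expMeasure_prod_real_sub_lt hb, laplaceCDF_div hv,
    laplaceCDF_neg]
  simp
  ring

/-- The mean of `f X_s`, where `s = 1` if `v * (Y₂ - Y₁) < X₁ - X₂` and `s = 2` otherwise, for
independent exponential variables `X₁`, `X₂` of rate `a` and `Y₁`, `Y₂` of rate `b`, in terms of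
the Laplace transform of `f`. -/
lemma integral_weightedDifference {a b v c : ℝ} (ha : 0 < a) (hb : 0 < b) (hv : 0 < v)
    (hc : c = b / v) (hac : c ≠ a) {f : ℝ → ℝ} (hfm : Measurable f)
    (hf : ∀ p, 0 < p → IntegrableOn (fun x => f x * exp (-p * x)) (Ioi 0)) :
    ∫ p : (ℝ × ℝ) × (ℝ × ℝ),
        (if v * (p.2.2 - p.2.1) < p.1.1 - p.1.2 then f p.1.1 else f p.1.2)
        ∂(((expMeasure a).prod (expMeasure a)).prod ((expMeasure b).prod (expMeasure b)))
      = 2 * a * ((∫ x in Ioi 0, f x * exp (-a * x))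
          - c ^ 2 / (c ^ 2 - a ^ 2) * (∫ x in Ioi 0, f x * exp (-(2 * a) * x))
          + a / (2 * (c - a)) * ∫ x in Ioi 0, f x * exp (-(a + c) * x)) := by
  have := isProbabilityMeasure_expMeasure ha
  have := isProbabilityMeasure_expMeasure hb
  have hc0 : 0 < c := hc ▸ div_pos hb hv
  have hfi : Integrable f (expMeasure a) := integrable_expMeasure ha (hf a ha)
  have hf1 : Integrable (fun p : ℝ × ℝ => f p.1) ((expMeasure a).prod (expMeasure a)) :=
    hfi.comp_fst _
  have hf2 : Integrable (fun p : ℝ × ℝ => f p.2) ((expMeasure a).prod (expMeasure a)) :=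
    hfi.comp_snd _
  have hS : MeasurableSet {p : (ℝ × ℝ) × (ℝ × ℝ) | v * (p.2.2 - p.2.1) < p.1.1 - p.1.2} :=
    measurableSet_lt (by fun_prop) (by fun_prop)
  rw [integral_prod]
  swap
  · refine Integrable.mono' ((hf1.abs.add hf2.abs).comp_fst _)
      (Measurable.ite hS (by fun_prop) (by fun_prop)).aestronglyMeasurable
      (ae_of_all _ fun p => ?_)
    simp only [Pi.add_apply, Real.norm_eq_abs]
    split_ifs
    · linarith [abs_nonneg (f p.1.2)]
    · linarith [abs_nonneg (f p.1.1)]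
  simp_rw [integral_ite_sub_lt hb hv, ← hc, neg_sub]
  have i1 : Integrable (fun p : ℝ × ℝ => f p.1 * laplaceCDF c (p.1 - p.2))
      ((expMeasure a).prod (expMeasure a)) := by
    refine Integrable.mono' hf1.abs (by fun_prop) (ae_of_all _ fun p => ?_)
    obtain ⟨h0, h1⟩ := laplaceCDF_mem_Icc hc0 (p.1 - p.2)
    rw [Real.norm_eq_abs, abs_mul, abs_of_nonneg h0]
    exact mul_le_of_le_one_right (abs_nonneg _) h1
  have i2 : Integrable (fun p : ℝ × ℝ => f p.2 * laplaceCDF c (p.2 - p.1))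
      ((expMeasure a).prod (expMeasure a)) := i1.swap
  have hswap := integral_prod_swap (μ := expMeasure a) (ν := expMeasure a)
    (fun p : ℝ × ℝ => f p.1 * laplaceCDF c (p.1 - p.2))
  simp only [Prod.fst_swap, Prod.snd_swap] at hswap
  rw [integral_add i1 i2, hswap, ← two_mul, integral_prod _ i1]
  simp only [integral_const_mul]
  rw [integral_expMeasure ha]
  have e : EqOn
      (fun x => a * (f x * (∫ y, laplaceCDF c (x - y) ∂(expMeasure a)) * exp (-a * x)))
      (fun x => a * (f x * exp (-a * x)
        - c ^ 2 / (c ^ 2 - a ^ 2) * (f x * exp (-(2 * a) * x))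
        + a / (2 * (c - a)) * (f x * exp (-(a + c) * x)))) (Ioi 0) := by
    intro x hx
    simp only
    rw [integral_laplaceCDF_expMeasure ha hc0 hac hx]
    have h1 : exp (-(2 * a) * x) = exp (-a * x) * exp (-a * x) := by rw [← exp_add]; ring_nf
    have h2 : exp (-(a + c) * x) = exp (-a * x) * exp (-c * x) := by rw [← exp_add]; ring_nf
    rw [h1, h2]
    ring
  have j1 := hf a ha
  have j2 := (hf (2 * a) (by positivity)).const_mul (c ^ 2 / (c ^ 2 - a ^ 2))
  have j12 : IntegrableOn (fun x => f x * exp (-a * x)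
      - c ^ 2 / (c ^ 2 - a ^ 2) * (f x * exp (-(2 * a) * x))) (Ioi 0) := j1.sub j2
  have j3 := (hf (a + c) (by positivity)).const_mul (a / (2 * (c - a)))
  rw [setIntegral_congr_fun measurableSet_Ioi e, integral_const_mul,
    integral_add j12 j3, integral_sub j1 j2, integral_const_mul, integral_const_mul]
  ring

lemma integrableOn_mul_exp_neg_mul_Ioi {p : ℝ} (hp : 0 < p) :
    IntegrableOn (fun x => x * exp (-p * x)) (Ioi 0) := by
  simpa using integrableOn_rpow_mul_exp_neg_mul_rpow (s := 1) (p := 1) (by norm_num) one_pos hp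

lemma integral_mul_exp_neg_mul_Ioi {p : ℝ} (hp : 0 < p) :
    ∫ x in Ioi 0, x * exp (-p * x) = 1 / p ^ 2 := by
  have h := integral_rpow_mul_exp_neg_mul_Ioi (a := 2) two_pos hp
  norm_num [Real.Gamma_two] at h
  simpa using h

lemma integrableOn_log_one_add_mul_exp {p : ℝ} (hp : 0 < p) :
    IntegrableOn (fun x => log (1 + x) * exp (-p * x)) (Ioi 0) := by
  refine Integrable.mono' (integrableOn_mul_exp_neg_mul_Ioi hp)
    (by fun_prop) ((ae_restrict_iff' measurableSet_Ioi).mpr (ae_of_all _ fun x (hx : 0 < x) => ?_))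
  rw [Real.norm_eq_abs, abs_mul, abs_of_nonneg (log_nonneg (by linarith)), abs_exp]
  gcongr
  linarith [log_le_sub_one_of_pos (show 0 < 1 + x by linarith)]

lemma integral_log_one_add_mul_exp {p : ℝ} (hp : 0 < p) :
    ∫ x in Ioi 0, log (1 + x) * exp (-p * x) = exp p * E1 p / p := by
  have hu : ∀ x ∈ Ioi (0 : ℝ), HasDerivAt (fun x => log (1 + x)) (1 / (1 + x)) x :=
    fun x (hx : 0 < x) => ((hasDerivAt_id x).const_add 1).log (by simp only [id]; linarith)
  have hv : ∀ x ∈ Ioi (0 : ℝ), HasDerivAt (fun x => -exp (-p * x) / p) (exp (-p * x)) x := by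
    intro x _
    refine (((hasDerivAt_id x).const_mul (-p)).exp.neg.div_const p).congr_deriv ?_
    simp only [id]
    field_simp
  have hi : IntegrableOn (fun x => 1 / (1 + x) * (-exp (-p * x) / p)) (Ioi 0) := by
    refine Integrable.mono' ((exp_neg_integrableOn_Ioi 0 hp).div_const p) (by fun_prop)
      ((ae_restrict_iff' measurableSet_Ioi).mpr (ae_of_all _ fun x (hx : 0 < x) => ?_))
    rw [Real.norm_eq_abs, abs_mul, abs_of_nonneg (by positivity), abs_div, abs_neg, abs_exp,
      abs_of_pos hp]
    exact mul_le_of_le_one_left (by positivity)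
      ((div_le_one (by linarith)).mpr (by linarith))
  have h0 : Tendsto ((fun x => log (1 + x)) * fun x => -exp (-p * x) / p) (𝓝[>] 0) (𝓝 0) := by
    have hc : ContinuousAt ((fun x => log (1 + x)) * fun x => -exp (-p * x) / p) 0 :=
      ContinuousAt.mul (ContinuousAt.log (by fun_prop) (by norm_num)) (by fun_prop)
    simpa [ContinuousAt] using hc.tendsto.mono_left nhdsWithin_le_nhds
  have hinf : Tendsto ((fun x => log (1 + x)) * fun x => -exp (-p * x) / p) atTop (𝓝 0) := by
    have ht : Tendsto (fun x : ℝ => x * exp (-p * x) / p) atTop (𝓝 0) := by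
      have := (tendsto_rpow_mul_exp_neg_mul_atTop_nhds_zero 1 p hp).div_const p
      simpa using this
    refine squeeze_zero_norm' ?_ ht
    filter_upwards [eventually_gt_atTop 0] with x hx
    rw [Pi.mul_apply, Real.norm_eq_abs, abs_mul, abs_of_nonneg (log_nonneg (by linarith)),
      abs_div, abs_neg, abs_exp, abs_of_pos hp, mul_div_assoc]
    gcongr
    linarith [log_le_sub_one_of_pos (show 0 < 1 + x by linarith)]
  rw [integral_Ioi_mul_deriv_eq_deriv_mul hu hv (integrableOn_log_one_add_mul_exp hp) hi h0 hinf]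
  have hE : E1 p = ∫ x in Ioi (0 : ℝ), exp (-p * (x + 1)) / (x + 1) := by
    have := (measurePreserving_add_right volume (1 : ℝ)).setIntegral_preimage_emb
      (measurableEmbedding_addRight 1) (fun y => exp (-p * y) / y) (Ioi 1)
    rw [E1, ← this]
    simp
  rw [hE, ← integral_const_mul, ← integral_div, sub_zero, zero_sub, ← integral_neg]
  refine setIntegral_congr_fun measurableSet_Ioi fun x (hx : 0 < x) => ?_
  have h1 : exp (-p * x) = exp p * exp (-p * (x + 1)) := by rw [← exp_add]; ring_nf
  simp only [h1, add_comm 1 x]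
  field_simp

lemma integral_wdMeasure {γbar εbar : ℝ} (hγ : 0 < γbar) (hε : 0 < εbar)
    (g : (ℝ × ℝ) × (ℝ × ℝ) → ℝ) :
    ∫ ω, g ((ω.1, ω.2.1), ω.2.2) ∂(wdMeasure γbar εbar)
      = ∫ p, g p ∂(((expMeasure (2 / γbar)).prod (expMeasure (2 / γbar))).prod
          ((expMeasure (1 / εbar)).prod (expMeasure (1 / εbar)))) := by
  have := isProbabilityMeasure_expMeasure (show 0 < 2 / γbar by positivity)
  have := isProbabilityMeasure_expMeasure (show 0 < 1 / εbar by positivity)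
  exact ((measurePreserving_prodAssoc _ _ _).symm _).integral_comp
    MeasurableEquiv.prodAssoc.symm.measurableEmbedding g

/-- Proposition 1: the capacity–energy tradeoff achieved by the weighted difference
relay selection scheme.  With `k = √(ε̄/(3ε̄-2ε)) - 1` and `ν = γ̄k/(2ε̄)`, the scheme
(select relay 1 iff `γ₁ - γ₂ > ν(ε₂ - ε₁)`) achieves (i) average energy transfer `ε`
and (ii) the stated ergodic capacity. -/
theorem weightedDifference_tradeoff (γbar εbar ε : ℝ) (hγ : 0 < γbar) (hε : 0 < εbar)
    (hεrange : ε ∈ Set.Ioo εbar (3 / 2 * εbar))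
    (k ν : ℝ) (hk : k = Real.sqrt (εbar / (3 * εbar - 2 * ε)) - 1) (hk1 : k ≠ 1)
    (hν : ν = γbar * k / (2 * εbar)) :
    (∫ ω, (if ν * (ω.2.2.2 - ω.2.2.1) < ω.1 - ω.2.1 then ω.2.2.1 else ω.2.2.2)
        ∂(wdMeasure γbar εbar)) = ε
    ∧ (∫ ω, (1 / 2) *
        (Real.log (1 + (if ν * (ω.2.2.2 - ω.2.2.1) < ω.1 - ω.2.1 then ω.1 else ω.2.1))
          / Real.log 2) ∂(wdMeasure γbar εbar))
      = Real.exp (2 / γbar) *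
          (2 * (1 - k ^ 2) * E1 (2 / γbar)
            + k ^ 2 * Real.exp (2 / (γbar * k)) * E1 ((2 / γbar) * (1 + 1 / k))
            - Real.exp (2 / γbar) * E1 (4 / γbar))
        / (2 * (1 - k ^ 2) * Real.log 2) := by
  have hd : 0 < 3 * εbar - 2 * ε := by linarith [hεrange.2]
  have hsq : (k + 1) ^ 2 = εbar / (3 * εbar - 2 * ε) := by
    rw [hk, sub_add_cancel, sq_sqrt (by positivity)]
  have hk0 : 0 < k := by
    rw [hk, sub_pos, lt_sqrt zero_le_one, one_pow, one_lt_div hd]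
    linarith [hεrange.1]
  have hν0 : 0 < ν := by rw [hν]; positivity
  have ha : 0 < 2 / γbar := by positivity
  have hb : 0 < 1 / εbar := by positivity
  have hk1' : k - 1 ≠ 0 := sub_ne_zero.mpr hk1
  have hk2 : 1 - k ^ 2 ≠ 0 := by
    rw [show 1 - k ^ 2 = -((k - 1) * (k + 1)) by ring]
    exact neg_ne_zero.mpr (mul_ne_zero hk1' (by positivity))
  constructor
  · have := isProbabilityMeasure_expMeasure ha
    have := isProbabilityMeasure_expMeasure hb
    rw [integral_wdMeasure hγ hε (fun p => if ν * (p.2.2 - p.2.1) < p.1.1 - p.1.2 then p.2.1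
      else p.2.2), ← integral_prod_swap]
    have hcond : ∀ p : (ℝ × ℝ) × (ℝ × ℝ), ν * (p.1.2 - p.1.1) < p.2.1 - p.2.2 ↔
        ν⁻¹ * (p.2.2 - p.2.1) < p.1.1 - p.1.2 := by
      intro p
      rw [inv_mul_lt_iff₀ hν0]
      constructor <;> intro h <;> linarith
    have hc : k / εbar = 2 / γbar / ν⁻¹ := by rw [hν]; field_simp
    have hac : k / εbar ≠ 1 / εbar := fun h => hk1 (by field_simp at h; exact h)
    simp only [Prod.fst_swap, Prod.snd_swap, hcond]
    rw [integral_weightedDifference (f := fun x => x) hb ha (inv_pos.mpr hν0) hc hac measurable_id'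
      fun p hp => integrableOn_mul_exp_neg_mul_Ioi hp]
    rw [integral_mul_exp_neg_mul_Ioi (by positivity), integral_mul_exp_neg_mul_Ioi (by positivity),
      integral_mul_exp_neg_mul_Ioi (by positivity)]
    have hε' : ε = εbar * (3 / 2 - 1 / (2 * (k + 1) ^ 2)) := by
      rw [hsq]; field_simp; ring
    have e1 : (k / εbar) ^ 2 / ((k / εbar) ^ 2 - (1 / εbar) ^ 2) = k ^ 2 / ((k - 1) * (k + 1)) := by
      rw [show (k / εbar) ^ 2 - (1 / εbar) ^ 2 = (k - 1) * (k + 1) / εbar ^ 2 by ring]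
      field_simp
    have e2 : 1 / εbar / (2 * (k / εbar - 1 / εbar)) = 1 / (2 * (k - 1)) := by
      rw [show k / εbar - 1 / εbar = (k - 1) / εbar by ring]
      field_simp
    have e3 : 1 / εbar + k / εbar = (k + 1) / εbar := by ring
    rw [e1, e2, e3, hε']
    field_simp
    ring
  · rw [integral_wdMeasure hγ hε (fun p => 1 / 2 * (log (1 + if ν * (p.2.2 - p.2.1) <
      p.1.1 - p.1.2 then p.1.1 else p.1.2) / log 2))]
    have hc : 2 / (γbar * k) = 1 / εbar / ν := by rw [hν]; field_simp
    have hac : 2 / (γbar * k) ≠ 2 / γbar := fun h => hk1 (by field_simp at h; exact h.symm)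
    simp only [integral_const_mul, integral_div, apply_ite (fun x => log (1 + x))]
    rw [integral_weightedDifference (f := fun x => log (1 + x)) ha hb hν0 hc hac (by fun_prop)
      fun p hp => integrableOn_log_one_add_mul_exp hp]
    rw [integral_log_one_add_mul_exp (by positivity), integral_log_one_add_mul_exp (by positivity),
      integral_log_one_add_mul_exp (by positivity)]
    have e1 : (2 / (γbar * k)) ^ 2 / ((2 / (γbar * k)) ^ 2 - (2 / γbar) ^ 2) = 1 / (1 - k ^ 2) := by
      rw [show (2 / (γbar * k)) ^ 2 - (2 / γbar) ^ 2 = 4 * (1 - k ^ 2) / (γbar * k) ^ 2 by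
        field_simp; ring]
      field_simp
      norm_num
    have e2 : 2 / γbar / (2 * (2 / (γbar * k) - 2 / γbar)) * (1 / (2 / γbar + 2 / (γbar * k)))
        = γbar * k ^ 2 / (4 * (1 - k ^ 2)) := by
      have hk3 : 1 - k ≠ 0 := fun h => hk1' (by linarith)
      rw [show 2 / (γbar * k) - 2 / γbar = 2 * (1 - k) / (γbar * k) by field_simp,
        show 1 - k ^ 2 = (1 - k) * (1 + k) by ring]
      field_simp
      ring
    have e3 : 2 / γbar * (1 + 1 / k) = 2 / γbar + 2 / (γbar * k) := by field_simp
    have e4 : 2 * (2 / γbar) = 4 / γbar := by ring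
    have e5 : exp (4 / γbar) = exp (2 / γbar) * exp (2 / γbar) := by rw [← exp_add]; ring_nf
    have hl : log 2 ≠ 0 := (log_pos one_lt_two).ne'
    rw [e1, e3, e4, e5, div_eq_mul_one_div _ (2 / γbar + 2 / (γbar * k)),
      mul_comm (exp (2 / γbar + 2 / (γbar * k)) * _), ← mul_assoc, e2, exp_add]
    field_simp
    ring
end

section
/- Fix γ̄ > 0, ε̄ > 0, γ_th > 0 and ν > 0 with 2νε̄ ≠ γ̄. Let γ₁, γ₂ be i.i.d. with density (2/γ̄)e^{−2x/γ̄}, ε₁, ε₂ i.i.d. exponential with mean ε̄, all independent, and let s = 1 if γ₁ − γ₂ > ν(ε₂ − ε₁), s = 2 otherwise. Then the outage probability satisfies P(γ_s < γ_th) = [ e^{−4γ_th/γ̄} (e^{2γ_th/γ̄} − 1)² γ̄² + 4ν²ε̄² ( e^{−2γ_th/γ̄} (2 − e^{−γ_th/(νε̄)}) − 1 ) ] / (γ̄² − 4ν²ε̄²). (Equation (51) in Appendix D: the outage probability of the weighted difference scheme as a function of ν.) -/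
open MeasureTheory ProbabilityTheory Real

/-- Integration against an exponential law, as integration over `(0, ∞)` with its density. -/
lemma lintegral_expMeasure (r : ℝ) {f : ℝ → ENNReal} (hf : Measurable f) :
    ∫⁻ x, f x ∂(expMeasure r)
      = ∫⁻ x in Set.Ioi 0, ENNReal.ofReal (r * exp (-(r * x))) * f x := by
  have hm : Measurable (gammaPDF 1 r) := (measurable_gammaPDFReal 1 r).ennreal_ofReal
  rw [expMeasure, gammaMeasure, lintegral_withDensity_eq_lintegral_mul _ hm hf,
    setLIntegral_congr Ioi_ae_eq_Ici, ← lintegral_indicator measurableSet_Ici]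
  refine lintegral_congr fun x => ?_
  change exponentialPDF r x * f x = _
  rw [exponentialPDF_eq]
  by_cases hx : 0 ≤ x <;> simp [Set.indicator, hx]

lemma setLIntegral_expMeasure_exp_mul {r : ℝ} (hr : 0 < r) (k : ℝ) {S : Set ℝ}
    (hS : MeasurableSet S) :
    ∫⁻ x in S, ENNReal.ofReal (exp (k * x)) ∂(expMeasure r)
      = ENNReal.ofReal r * ∫⁻ x in S ∩ Set.Ioi 0, ENNReal.ofReal (exp ((k - r) * x)) := by
  rw [← lintegral_indicator hS,
    lintegral_expMeasure r (Measurable.indicator (by fun_prop) hS),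
    ← lintegral_const_mul _ (by fun_prop), ← Measure.restrict_restrict hS,
    ← lintegral_indicator hS]
  refine lintegral_congr fun x => ?_
  by_cases hx : x ∈ S
  · simp only [Set.indicator_of_mem hx]
    rw [← ENNReal.ofReal_mul (by positivity), ← ENNReal.ofReal_mul (by positivity), mul_assoc,
      ← exp_add]
    ring_nf
  · simp [hx]

lemma setLIntegral_Ici_expMeasure_exp_mul {r k u : ℝ} (hr : 0 < r) (hk : k < r) (hu : 0 ≤ u) :
    ∫⁻ x in Set.Ici u, ENNReal.ofReal (exp (k * x)) ∂(expMeasure r)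
      = ENNReal.ofReal (r / (r - k) * exp ((k - r) * u)) := by
  have hkr : k - r < 0 := by linarith
  have hae : (Set.Ici u ∩ Set.Ioi 0 : Set ℝ) =ᵐ[volume] Set.Ioi u := by
    have h := (Ioi_ae_eq_Ici (μ := volume) (a := u)).symm.inter
      (Filter.EventuallyEq.refl (ae volume) (Set.Ioi (0 : ℝ)))
    rwa [Set.Ioi_inter_Ioi, max_eq_left hu] at h
  rw [setLIntegral_expMeasure_exp_mul hr k measurableSet_Ici, setLIntegral_congr hae,
    ← ofReal_integral_eq_lintegral_ofReal (integrableOn_exp_mul_Ioi hkr u)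
      (ae_of_all _ fun x => (exp_pos _).le),
    integral_exp_mul_Ioi hkr, ← ENNReal.ofReal_mul hr.le]
  congr 1
  have : r - k ≠ 0 := by linarith
  have : k - r ≠ 0 := hkr.ne
  rw [← neg_sub r k]
  field_simp

lemma setLIntegral_Iio_expMeasure_exp_mul {r k t : ℝ} (hr : 0 < r) (hk : k ≠ r) (ht : 0 ≤ t) :
    ∫⁻ x in Set.Iio t, ENNReal.ofReal (exp (k * x)) ∂(expMeasure r)
      = ENNReal.ofReal (r / (k - r) * (exp ((k - r) * t) - 1)) := by
  have hkr : k - r ≠ 0 := sub_ne_zero.2 hk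
  have hset : (Set.Iio t ∩ Set.Ioi 0 : Set ℝ) = Set.Ioo 0 t := by
    ext x; simp [and_comm]
  have hint : IntegrableOn (fun x => exp ((k - r) * x)) (Set.Ioc 0 t) :=
    (Continuous.integrableOn_Icc (by fun_prop)).mono_set Set.Ioc_subset_Icc_self
  rw [setLIntegral_expMeasure_exp_mul hr k measurableSet_Iio, hset,
    setLIntegral_congr Ioo_ae_eq_Ioc,
    ← ofReal_integral_eq_lintegral_ofReal hint (ae_of_all _ fun x => (exp_pos _).le),
    ← intervalIntegral.integral_of_le ht, intervalIntegral.integral_comp_mul_left _ hkr,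
    integral_exp, ← ENNReal.ofReal_mul hr.le]
  congr 1
  simp only [mul_zero, exp_zero, smul_eq_mul]
  field_simp

lemma expMeasure_Ici {r u : ℝ} (hr : 0 < r) (hu : 0 ≤ u) :
    expMeasure r (Set.Ici u) = ENNReal.ofReal (exp (-(r * u))) := by
  simpa [hr.ne'] using setLIntegral_Ici_expMeasure_exp_mul (k := 0) hr hr hu

lemma expMeasure_Ioi {r u : ℝ} (hr : 0 < r) (hu : 0 ≤ u) :
    expMeasure r (Set.Ioi u) = ENNReal.ofReal (exp (-(r * u))) := by
  rw [← expMeasure_Ici hr hu]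
  exact measure_congr ((withDensity_absolutelyContinuous _ _).ae_eq Ioi_ae_eq_Ici)

lemma expMeasure_Iio {r u : ℝ} (hr : 0 < r) (hu : 0 ≤ u) :
    expMeasure r (Set.Iio u) = ENNReal.ofReal (1 - exp (-(r * u))) := by
  have h := setLIntegral_Iio_expMeasure_exp_mul (k := 0) hr hr.ne hu
  simp only [zero_mul, exp_zero, ENNReal.ofReal_one, setLIntegral_one] at h
  rw [h, zero_sub, div_neg, div_self hr.ne', neg_mul]
  ring_nf

lemma lintegral_expMeasure_exp_neg_add {r u : ℝ} (hr : 0 < r) {f : ℝ → ENNReal}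
    (hf : Measurable f) (h : ∀ x, 0 < x → f x = ENNReal.ofReal (exp (-(r * (u + x))))) :
    ∫⁻ x, f x ∂(expMeasure r) = ENNReal.ofReal (exp (-(r * u)) / 2) := by
  have hr2 : -(2 * r) < 0 := by linarith
  have hcongr : ∀ x ∈ Set.Ioi (0 : ℝ), ENNReal.ofReal (r * exp (-(r * x))) * f x
      = ENNReal.ofReal (r * exp (-(r * u))) * ENNReal.ofReal (exp (-(2 * r) * x)) := by
    intro x hx
    rw [h x hx, ← ENNReal.ofReal_mul (by positivity), ← ENNReal.ofReal_mul (by positivity),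
      mul_assoc, mul_assoc, ← exp_add, ← exp_add]
    ring_nf
  rw [lintegral_expMeasure r hf, setLIntegral_congr_fun measurableSet_Ioi hcongr,
    lintegral_const_mul _ (by fun_prop),
    ← ofReal_integral_eq_lintegral_ofReal (integrableOn_exp_mul_Ioi hr2 0)
      (ae_of_all _ fun x => (exp_pos _).le),
    integral_exp_mul_Ioi hr2, ← ENNReal.ofReal_mul (by positivity)]
  congr 1
  simp only [mul_zero, exp_zero]
  field_simp

lemma expMeasure_prod_le_sub {r u : ℝ} (hr : 0 < r) (hu : 0 ≤ u) :
    (expMeasure r).prod (expMeasure r) {p | u ≤ p.2 - p.1}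
      = ENNReal.ofReal (exp (-(r * u)) / 2) := by
  have := isProbabilityMeasure_expMeasure hr
  have hm : MeasurableSet {p : ℝ × ℝ | u ≤ p.2 - p.1} :=
    measurableSet_le (by fun_prop) (by fun_prop)
  rw [Measure.prod_apply hm]
  refine lintegral_expMeasure_exp_neg_add hr (measurable_measure_prodMk_left hm) fun x hx => ?_
  rw [← expMeasure_Ici hr (by positivity)]
  congr 1
  ext y
  simp [le_sub_iff_add_le]

lemma expMeasure_prod_lt_sub {r u : ℝ} (hr : 0 < r) (hu : 0 ≤ u) :
    (expMeasure r).prod (expMeasure r) {p | u < p.1 - p.2}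
      = ENNReal.ofReal (exp (-(r * u)) / 2) := by
  have := isProbabilityMeasure_expMeasure hr
  have hm : MeasurableSet {p : ℝ × ℝ | u < p.1 - p.2} :=
    measurableSet_lt (by fun_prop) (by fun_prop)
  rw [Measure.prod_apply_symm hm]
  refine lintegral_expMeasure_exp_neg_add hr (measurable_measure_prodMk_right hm) fun x hx => ?_
  rw [← expMeasure_Ioi hr (by positivity)]
  congr 1
  ext y
  simp [lt_sub_iff_add_lt]

/-- Conditional outage probability given `γ₁ = x` and `γ₂ = y`. -/
lemma expMeasure_prod_outage {r ν t : ℝ} (hr : 0 < r) (hν : 0 < ν) (x y : ℝ) :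
    (expMeasure r).prod (expMeasure r)
        {p | (if ν * (p.2 - p.1) < x - y then x else y) < t}
      = (Set.Iio t).indicator 1 x * (Set.Iio t).indicator 1 y
        + ((Set.Iio t).indicator (fun x => ENNReal.ofReal (exp (r / ν * x))) x
            * (Set.Ici t).indicator (fun y => ENNReal.ofReal (exp (-(r / ν) * y))) y
          + (Set.Ici t).indicator (fun y => ENNReal.ofReal (exp (-(r / ν) * y))) x
            * (Set.Iio t).indicator (fun x => ENNReal.ofReal (exp (r / ν * x))) y)
          * ENNReal.ofReal (1 / 2) := by
  have := isProbabilityMeasure_expMeasure hr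
  rcases lt_or_ge x t with hx | hx <;> rcases lt_or_ge y t with hy | hy
  · have : {p : ℝ × ℝ | (if ν * (p.2 - p.1) < x - y then x else y) < t} = Set.univ := by
      ext p; simp only [Set.mem_ofPred_eq, Set.mem_univ, iff_true]; split_ifs <;> assumption
    simp [this, hx, hy, hx.not_ge, hy.not_ge]
  · have : {p : ℝ × ℝ | (if ν * (p.2 - p.1) < x - y then x else y) < t}
        = {p | (y - x) / ν < p.1 - p.2} := by
      ext p
      simp only [Set.mem_ofPred_eq, div_lt_iff₀ hν]
      split_ifs with h
      · exact ⟨fun _ => by linarith, fun _ => hx⟩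
      · exact ⟨fun h' => absurd h' hy.not_gt, fun h' => absurd (by linarith) h⟩
    rw [this, expMeasure_prod_lt_sub hr (div_nonneg (by linarith) hν.le)]
    simp only [Set.indicator, Set.mem_Iio, Set.mem_Ici, hx, hy, hx.not_ge, hy.not_gt, if_true,
      if_false, mul_zero, zero_add, add_zero]
    rw [← ENNReal.ofReal_mul (exp_pos _).le, ← exp_add, ← ENNReal.ofReal_mul (exp_pos _).le]
    ring_nf
  · have : {p : ℝ × ℝ | (if ν * (p.2 - p.1) < x - y then x else y) < t}
        = {p | (x - y) / ν ≤ p.2 - p.1} := by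
      ext p
      simp only [Set.mem_ofPred_eq, div_le_iff₀ hν]
      split_ifs with h
      · exact ⟨fun h' => absurd h' hx.not_gt, fun h' => absurd h (by linarith)⟩
      · exact ⟨fun _ => by linarith, fun _ => hy⟩
    rw [this, expMeasure_prod_le_sub hr (div_nonneg (by linarith) hν.le)]
    simp only [Set.indicator, Set.mem_Iio, Set.mem_Ici, hx, hy, hy.not_ge, hx.not_gt, if_true,
      if_false, mul_zero, zero_mul, zero_add]
    rw [← ENNReal.ofReal_mul (exp_pos _).le, ← exp_add, ← ENNReal.ofReal_mul (exp_pos _).le]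
    ring_nf
  · have : {p : ℝ × ℝ | (if ν * (p.2 - p.1) < x - y then x else y) < t} = ∅ := by
      ext p
      simp only [Set.mem_ofPred_eq, Set.mem_empty_iff_false, iff_false, not_lt]
      split_ifs <;> assumption
    simp [this, hx, hy, hx.not_gt, hy.not_gt]

/-- The outage probability in terms of the rates `a` of the SNRs and `r` of the energies. -/
lemma expMeasure_outage {a r ν t : ℝ} (ha : 0 < a) (hr : 0 < r) (hν : 0 < ν) (ht : 0 < t)
    (hne : r / ν ≠ a) :
    (expMeasure a).prod ((expMeasure a).prod ((expMeasure r).prod (expMeasure r)))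
        {ω | (if ν * (ω.2.2.2 - ω.2.2.1) < ω.1 - ω.2.1 then ω.1 else ω.2.1) < t}
      = ENNReal.ofReal ((1 - exp (-(a * t))) ^ 2
          + a / (r / ν - a) * (exp ((r / ν - a) * t) - 1)
            * (a / (a + r / ν) * exp ((-(r / ν) - a) * t))) := by
  have := isProbabilityMeasure_expMeasure ha
  have := isProbabilityMeasure_expMeasure hr
  have hc : 0 < r / ν := div_pos hr hν
  have hm : MeasurableSet {ω : ℝ × ℝ × ℝ × ℝ |
      (if ν * (ω.2.2.2 - ω.2.2.1) < ω.1 - ω.2.1 then ω.1 else ω.2.1) < t} := by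
    refine measurableSet_lt (Measurable.ite (measurableSet_lt ?_ ?_) ?_ ?_) ?_ <;> fun_prop
  have hJ := setLIntegral_Iio_expMeasure_exp_mul ha hne ht.le
  have hK := setLIntegral_Ici_expMeasure_exp_mul (k := -(r / ν)) ha (by linarith) ht.le
  have hI := expMeasure_Iio ha ht.le
  rw [← lintegral_indicator_one measurableSet_Iio] at hI
  rw [← lintegral_indicator measurableSet_Iio] at hJ
  rw [← lintegral_indicator measurableSet_Ici, sub_neg_eq_add] at hK
  have mI : Measurable ((Set.Iio t).indicator (1 : ℝ → ENNReal)) :=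
    measurable_one.indicator measurableSet_Iio
  have mJ : Measurable ((Set.Iio t).indicator
      (fun x => ENNReal.ofReal (exp (r / ν * x)))) :=
    Measurable.indicator (by fun_prop) measurableSet_Iio
  have mK : Measurable ((Set.Ici t).indicator
      (fun x => ENNReal.ofReal (exp (-(r / ν) * x)))) :=
    Measurable.indicator (by fun_prop) measurableSet_Ici
  have hslice : ∀ x, (expMeasure a).prod ((expMeasure r).prod (expMeasure r))
      (Prod.mk x ⁻¹' {ω : ℝ × ℝ × ℝ × ℝ |
        (if ν * (ω.2.2.2 - ω.2.2.1) < ω.1 - ω.2.1 then ω.1 else ω.2.1) < t})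
      = ∫⁻ y, ((expMeasure r).prod (expMeasure r))
        {p | (if ν * (p.2 - p.1) < x - y then x else y) < t} ∂(expMeasure a) := fun x =>
    Measure.prod_apply (measurable_prodMk_left hm)
  have hJ0 : 0 ≤ a / (r / ν - a) * (exp ((r / ν - a) * t) - 1) := by
    rcases lt_or_gt_of_ne hne with h | h
    · refine mul_nonneg_of_nonpos_of_nonpos
        (div_nonpos_of_nonneg_of_nonpos ha.le (by linarith)) ?_
      have : exp ((r / ν - a) * t) ≤ 1 := exp_le_one_iff.2
        (mul_nonpos_of_nonpos_of_nonneg (by linarith) ht.le)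
      linarith
    · refine mul_nonneg (div_nonneg ha.le (by linarith)) ?_
      have : 1 ≤ exp ((r / ν - a) * t) := one_le_exp (mul_nonneg (by linarith) ht.le)
      linarith
  have hK0 : 0 ≤ a / (a + r / ν) * exp ((-(r / ν) - a) * t) := by positivity
  have hI0 : 0 ≤ 1 - exp (-(a * t)) := by
    have : exp (-(a * t)) ≤ 1 := exp_le_one_iff.2 (by nlinarith)
    linarith
  rw [Measure.prod_apply hm]
  simp only [hslice, expMeasure_prod_outage hr hν]
  simp (discharger := fun_prop) only [lintegral_add_left,
    lintegral_const_mul, lintegral_mul_const, hI, hJ, hK]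
  rw [← ENNReal.ofReal_mul hI0, ← ENNReal.ofReal_mul hJ0, ← ENNReal.ofReal_mul hK0,
    ← ENNReal.ofReal_add (by positivity) (by positivity), ← ENNReal.ofReal_mul (by positivity),
    ← ENNReal.ofReal_add (by positivity) (by positivity)]
  ring_nf

/-- Equation (51) in Appendix D: the outage probability `P(γ_s < γ_th)` of the weighted
difference scheme (select relay 1 iff `γ₁ - γ₂ > ν(ε₂ - ε₁)`) as a function of `ν`. -/
theorem weightedDifference_outage (γbar εbar ν γth : ℝ) (hγ : 0 < γbar) (hε : 0 < εbar)
    (hν : 0 < ν) (hγth : 0 < γth) (hne : 2 * ν * εbar ≠ γbar) :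
    wdMeasure γbar εbar
        {ω | (if ν * (ω.2.2.2 - ω.2.2.1) < ω.1 - ω.2.1 then ω.1 else ω.2.1) < γth}
      = ENNReal.ofReal
          ((Real.exp (-4 * γth / γbar) * (Real.exp (2 * γth / γbar) - 1) ^ 2 * γbar ^ 2
              + 4 * ν ^ 2 * εbar ^ 2 *
                (Real.exp (-2 * γth / γbar) * (2 - Real.exp (-γth / (ν * εbar))) - 1))
            / (γbar ^ 2 - 4 * ν ^ 2 * εbar ^ 2)) := by
  have hν2 : 1 / εbar / ν ≠ 2 / γbar := by
    intro h
    apply hne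
    field_simp at h
    linarith
  rw [wdMeasure, expMeasure_outage (by positivity) (by positivity) hν hγth hν2]
  congr 1
  have e1 : exp (-4 * γth / γbar) = exp (-(2 / γbar * γth)) ^ 2 := by
    rw [← exp_nat_mul]; congr 1; push_cast; ring
  have e2 : exp (2 * γth / γbar) = (exp (-(2 / γbar * γth)))⁻¹ := by
    rw [← exp_neg]; congr 1; ring
  have e3 : exp (-2 * γth / γbar) = exp (-(2 / γbar * γth)) := by
    congr 1; ring
  have e4 : exp ((1 / εbar / ν - 2 / γbar) * γth)
      = (exp (-γth / (ν * εbar)))⁻¹ * exp (-(2 / γbar * γth)) := by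
    rw [← exp_neg, ← exp_add]; congr 1; field_simp; ring
  have e5 : exp ((-(1 / εbar / ν) - 2 / γbar) * γth)
      = exp (-γth / (ν * εbar)) * exp (-(2 / γbar * γth)) := by
    rw [← exp_add]; congr 1; field_simp; ring
  rw [e1, e2, e3, e4, e5]
  have hE := (exp_pos (-(2 / γbar * γth))).ne'
  have hF := (exp_pos (-γth / (ν * εbar))).ne'
  generalize exp (-(2 / γbar * γth)) = E at hE ⊢
  generalize exp (-γth / (ν * εbar)) = F at hF ⊢
  have hd : γbar - 2 * ν * εbar ≠ 0 := sub_ne_zero.2 hne.symm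
  have hs : γbar + 2 * ν * εbar ≠ 0 := by positivity
  have h1 : 2 / γbar / (1 / εbar / ν - 2 / γbar) = 2 * ν * εbar / (γbar - 2 * ν * εbar) := by
    have : 1 / εbar / ν - 2 / γbar ≠ 0 := sub_ne_zero.2 hν2
    rw [div_eq_div_iff this hd]
    field_simp
  have h2 : 2 / γbar / (2 / γbar + 1 / εbar / ν) = 2 * ν * εbar / (γbar + 2 * ν * εbar) := by
    rw [div_eq_div_iff (by positivity) hs]
    field_simp
    ring
  have h3 : γbar ^ 2 - 4 * ν ^ 2 * εbar ^ 2
      = (γbar - 2 * ν * εbar) * (γbar + 2 * ν * εbar) := by ring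
  rw [h1, h2, h3]
  field_simp
  ring
end
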